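/- Let G be a finite group whose order is square-free. Then for all subgroups H, J ≤ G and all l ≥ 1 there is an isomorphism of A(G)-modules Ext^l_{A(G)}(ℤ_H, ℤ_J) ≅ Ext^{l+2}_{A(G)}(ℤ_H, ℤ_J). -/

import Mathlib

set_option synthInstance.maxHeartbeats 400000
set_option maxHeartbeats 1000000

noncomputable section

open CategoryTheory

/-- Two subgroups of `G` are conjugate if one is `g H g⁻¹` for some `g ∈ G`. -/
def IsConjSubgroup {G : Type*} [Group G] (H J : Subgroup G) : Prop :=
  ∃ g : G, Subgroup.map (MulAut.conj g).toMonoidHom H = J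

/-- The Burnside ring `A(G)` of a finite group `G`, realized via the mark homomorphisms as the
subring of the ghost ring `∏_{H ≤ G} ℤ` generated by the mark vectors `H ↦ |X^H|` of finite
`G`-sets `X`.  (Marks are constant on conjugacy classes of subgroups, so this is the image of
the usual embedding `A(G) → ∏_{(H) ∈ ccs(G)} ℤ`, hence isomorphic to the Burnside ring.) -/
def burnsideRing (G : Type) [Group G] : Subring ((Subgroup G) → ℤ) :=
  Subring.closure { f | ∃ (X : Type) (_ : Fintype X) (_ : MulAction G X),
    f = fun H : Subgroup G => (Nat.card (MulAction.fixedPoints H X) : ℤ) }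

/-- `ℤ_H`: the `A(G)`-module `ℤ` on which `a ∈ A(G)` acts by multiplication by `π_H(a)`,
the `H`-mark of `a`. -/
def ZB (G : Type) [Group G] (H : Subgroup G) : ModuleCat (burnsideRing G) :=
  letI : Module (burnsideRing G) ℤ :=
    Module.compHom ℤ ((Pi.evalRingHom (fun _ => ℤ) H).comp (burnsideRing G).subtype)
  ModuleCat.of _ ℤ

section DimensionShift

universe u v

variable {C : Type u} [Category.{v} C] [Abelian C]

namespace CategoryTheory.ProjectiveResolution

/-- The augmentation `P₀ ⟶ Z` of a projective resolution of `Z`. -/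
def augmentation {Z : C} (P : ProjectiveResolution Z) : P.complex.X 0 ⟶ Z :=
  P.π.f 0

instance {Z : C} (P : ProjectiveResolution Z) : Epi P.augmentation :=
  inferInstanceAs (Epi (P.π.f 0))

lemma d_comp_augmentation {Z : C} (P : ProjectiveResolution Z) :
    P.complex.d 1 0 ≫ P.augmentation = 0 :=
  P.complex_d_comp_π_f_zero

lemma exact_augmentation {Z : C} (P : ProjectiveResolution Z) :
    (ShortComplex.mk _ _ P.d_comp_augmentation).Exact :=
  ShortComplex.exact_of_g_is_cokernel _ P.isColimitCokernelCofork

/-- The complex obtained from a projective resolution of `S.X₁` by putting `S.X₂` in degree `0`. -/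
def spliceComplex (S : ShortComplex C) (Q : ProjectiveResolution S.X₁) : ChainComplex C ℕ :=
  Q.complex.augment (Q.augmentation ≫ S.f)
    (by rw [← Category.assoc, Q.d_comp_augmentation, Limits.zero_comp])

lemma spliceComplex_d_one_zero (S : ShortComplex C) (Q : ProjectiveResolution S.X₁) :
    (spliceComplex S Q).d 1 0 = Q.augmentation ≫ S.f := rfl

lemma spliceComplex_d_succ_succ (S : ShortComplex C) (Q : ProjectiveResolution S.X₁) (i j : ℕ) :
    (spliceComplex S Q).d (i + 1) (j + 1) = Q.complex.d i j :=
  ChainComplex.augment_d_succ_succ _ _ _ _ _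

lemma spliceComplex_exactAt_succ {S : ShortComplex C} (hS : S.ShortExact)
    (Q : ProjectiveResolution S.X₁) (n : ℕ) : (spliceComplex S Q).ExactAt (n + 1) := by
  rw [HomologicalComplex.exactAt_iff' _ (n + 1 + 1) (n + 1) n (by simp) (by simp)]
  cases n with
  | zero =>
    have hmono : Mono S.f := hS.mono_f
    let φ : ShortComplex.mk _ _ Q.d_comp_augmentation ⟶
        (spliceComplex S Q).sc' (0 + 1 + 1) (0 + 1) 0 :=
      { τ₁ := 𝟙 (Q.complex.X 1), τ₂ := 𝟙 (Q.complex.X 0), τ₃ := S.f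
        comm₁₂ := (Category.id_comp _).trans (Category.comp_id _).symm
        comm₂₃ := Category.id_comp _ }
    have : Epi φ.τ₁ := inferInstanceAs (Epi (𝟙 _))
    have : IsIso φ.τ₂ := inferInstanceAs (IsIso (𝟙 _))
    have : Mono φ.τ₃ := hmono
    exact (ShortComplex.exact_iff_of_epi_of_isIso_of_mono φ).1 Q.exact_augmentation
  | succ n => exact Q.exact_succ n

/-- Splicing a projective resolution of `K` with a short exact sequence `0 ⟶ K ⟶ P ⟶ Z ⟶ 0`,
where `P` is projective, gives a projective resolution of `Z`. -/
def splice {S : ShortComplex C} (hS : S.ShortExact)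
    [Projective S.X₂] (Q : ProjectiveResolution S.X₁) : ProjectiveResolution S.X₃ where
  complex := spliceComplex S Q
  projective n := by
    cases n
    · assumption
    · exact Q.projective _
  π := (ChainComplex.toSingle₀Equiv _ _).symm ⟨S.g, by
    rw [spliceComplex_d_one_zero]
    exact (Category.assoc Q.augmentation S.f S.g).trans
      (by rw [S.zero]; exact Limits.comp_zero)⟩
  quasiIso := ⟨fun n => by
    have hepi : Epi S.g := hS.epi_g
    cases n with
    | zero =>
      rw [ChainComplex.quasiIsoAt₀_iff, ShortComplex.quasiIso_iff_of_zeros']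
      · let T : ShortComplex C := ShortComplex.mk (Q.augmentation ≫ S.f) S.g
          ((Category.assoc _ _ _).trans (by rw [S.zero, Limits.comp_zero]))
        have hex : T.Exact := by
          let φ : T ⟶ S :=
            { τ₁ := Q.augmentation, τ₂ := 𝟙 _, τ₃ := 𝟙 _
              comm₁₂ := (Category.comp_id _).symm
              comm₂₃ := (Category.id_comp _).trans (Category.comp_id _).symm }
          have : Epi φ.τ₁ := inferInstanceAs (Epi Q.augmentation)
          have : IsIso φ.τ₂ := inferInstanceAs (IsIso (𝟙 _))
          have : Mono φ.τ₃ := inferInstanceAs (Mono (𝟙 _))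
          exact (ShortComplex.exact_iff_of_epi_of_isIso_of_mono φ).2 hS.exact
        refine (ShortComplex.exact_and_epi_g_iff_of_iso (S₂ := T) ?_).2 ⟨hex, hepi⟩
        refine ShortComplex.isoMk (Iso.refl _) (Iso.refl _) (Iso.refl _)
          ((Category.id_comp _).trans (Category.comp_id _).symm) ?_
        refine (Category.id_comp _).trans ((Category.comp_id _).trans ?_).symm
        exact ChainComplex.toSingle₀Equiv_symm_apply_f_zero _ _
      all_goals rfl
    | succ n =>
      rw [quasiIsoAt_iff_exactAt']
      · exact spliceComplex_exactAt_succ hS Q n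
      · apply ChainComplex.exactAt_succ_single_obj⟩

end CategoryTheory.ProjectiveResolution

variable [EnoughProjectives C]

instance CategoryTheory.Functor.additive_leftDerived {D : Type*} [Category* D] [Abelian D]
    (F : C ⥤ D) [F.Additive] (n : ℕ) : (F.leftDerived n).Additive where
  map_add {X Y f g} := by
    let P := ProjectiveResolution.of X
    let Q := ProjectiveResolution.of Y
    have hf := ProjectiveResolution.lift_commutes f P Q
    have hg := ProjectiveResolution.lift_commutes g P Q
    rw [F.leftDerived_map_eq n f _ hf, F.leftDerived_map_eq n g _ hg,
      F.leftDerived_map_eq n (f + g)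
        (ProjectiveResolution.lift f P Q + ProjectiveResolution.lift g P Q)
        (by rw [Preadditive.add_comp, hf, hg, Functor.map_add, Preadditive.comp_add]),
      Functor.map_add, Preadditive.add_comp, Preadditive.comp_add]

variable {R : Type*} [Ring R] [Linear R C]

/-- Dimension shifting for `Ext`. -/
def extIsoOfShortExact {S : ShortComplex C} (hS : S.ShortExact) [Projective S.X₂] (Y : C) (n : ℕ) :
    ((Ext R C (n + 2)).obj (Opposite.op S.X₃)).obj Y ≅
      ((Ext R C (n + 1)).obj (Opposite.op S.X₁)).obj Y :=
  let Q := ProjectiveResolution.of S.X₁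
  (Q.splice hS).isoExt (n + 2) Y ≪≫
    HomologicalComplex.homologyIsoSc' _ (n + 1) (n + 2) (n + 3)
      (CochainComplex.prev_nat_succ (n + 1)) (CochainComplex.next ℕ (n + 2)) ≪≫
    ShortComplex.homologyMapIso (ShortComplex.isoMk (Iso.refl _) (Iso.refl _) (Iso.refl _)
      (by
        refine (Category.id_comp _).trans ((Category.comp_id _).trans ?_).symm
        change ((Q.splice hS).complex.linearYonedaObj R Y).d (n + 1) (n + 2) =
          (Q.complex.linearYonedaObj R Y).d n (n + 1)
        rw [ChainComplex.linearYonedaObj_d, ChainComplex.linearYonedaObj_d]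
        exact congrArg (fun f => ModuleCat.ofHom (Linear.leftComp R Y f))
          (ProjectiveResolution.spliceComplex_d_succ_succ S Q (n + 1) n))
      (by
        refine (Category.id_comp _).trans ((Category.comp_id _).trans ?_).symm
        change ((Q.splice hS).complex.linearYonedaObj R Y).d (n + 2) (n + 3) =
          (Q.complex.linearYonedaObj R Y).d (n + 1) (n + 2)
        rw [ChainComplex.linearYonedaObj_d, ChainComplex.linearYonedaObj_d]
        exact congrArg (fun f => ModuleCat.ofHom (Linear.leftComp R Y f))
          (ProjectiveResolution.spliceComplex_d_succ_succ S Q (n + 2) (n + 1)))) ≪≫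
    (HomologicalComplex.homologyIsoSc' (Q.complex.linearYonedaObj R Y) n (n + 1) (n + 2)
      (CochainComplex.prev_nat_succ n) (CochainComplex.next ℕ (n + 1))).symm ≪≫
    (Q.isoExt (n + 1) Y).symm


lemma nonempty_iso_of_comp_eq_zsmul {D : Type*} [Category* D] [Preadditive D] {A B : D}
    (f : A ⟶ B) (g : B ⟶ A) {m N : ℤ} (hmN : IsCoprime m N) (hfg : f ≫ g = m • 𝟙 A)
    (hgf : g ≫ f = m • 𝟙 B) (hA : N • 𝟙 A = 0) (hB : N • 𝟙 B = 0) : Nonempty (A ≅ B) := by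
  obtain ⟨s, t, h⟩ := hmN
  have key (X : D) (hX : N • 𝟙 X = 0) : s • m • 𝟙 X = 𝟙 X := by
    calc s • m • 𝟙 X = (s * m + t * N) • 𝟙 X := by rw [add_smul, mul_smul, mul_smul, hX]; simp
      _ = 𝟙 X := by rw [h, one_smul]
  exact ⟨⟨f, s • g, by rw [Preadditive.comp_zsmul, hfg, key A hA],
    by rw [Preadditive.zsmul_comp, hgf, key B hB]⟩⟩

/-- The functor `Ext R C n` in its first variable, as a covariant functor to the opposite
category. -/
abbrev extRightOp (R : Type*) [Ring R] [Linear R C] (Y : C) (n : ℕ) : C ⥤ (ModuleCat R)ᵒᵖ :=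
  ((linearYoneda R C).obj Y).rightOp.leftDerived n

instance (Y : C) (n : ℕ) : (extRightOp R Y n).Additive :=
  inferInstanceAs (((linearYoneda R C).obj Y).rightOp.leftDerived n).Additive

lemma zsmul_id_ext_eq_zero {X P : C} [Projective P] (i : X ⟶ P) (p : P ⟶ X) {N : ℤ}
    (h : i ≫ p = N • 𝟙 X) (Y : C) (n : ℕ) :
    N • 𝟙 (((Ext R C (n + 1)).obj (Opposite.op X)).obj Y) = 0 := by
  let F := extRightOp R Y (n + 1)
  have hF : F.Additive := inferInstanceAs (extRightOp R Y (n + 1)).Additive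
  have h0 : 𝟙 (F.obj P) = 0 :=
    Quiver.Hom.unop_inj ((isZero_Ext_succ_of_projective (R := R) P Y n).eq_of_src _ _)
  have h1 : N • 𝟙 (F.obj X) = 0 := by
    rw [← F.map_id, ← F.map_zsmul, ← h, F.map_comp, ← Category.comp_id (F.map i), h0]
    simp
  exact congrArg Quiver.Hom.unop h1

lemma zsmul_id_eq_zero_of_iso {D : Type*} [Category* D] [Preadditive D] {A B : D} (e : A ≅ B)
    {N : ℤ} (hA : N • 𝟙 A = 0) : N • 𝟙 B = 0 := by
  have : N • 𝟙 B = e.inv ≫ (N • 𝟙 A) ≫ e.hom := by simp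
  rw [this, hA, Limits.zero_comp, Limits.comp_zero]

/-- If the first syzygy of `Z` and a first cosyzygy of `Z` agree up to an integer `m`, and if
an integer `N` coprime to `m` annihilates the stable endomorphisms of `Z`,
then `Ext` out of `Z` is `2`-periodic. -/
theorem nonempty_ext_iso_ext_add_two {S T : ShortComplex C} (hS : S.ShortExact)
    (hT : T.ShortExact) [Projective S.X₂] [Projective T.X₂] (e : T.X₁ ≅ S.X₃)
    (f : T.X₃ ⟶ S.X₁) (g : S.X₁ ⟶ T.X₃) {m N : ℤ} (hmN : IsCoprime m N)
    (hfg : f ≫ g = m • 𝟙 _) (hgf : g ≫ f = m • 𝟙 _)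
    {P : C} [Projective P] (i : S.X₃ ⟶ P) (p : P ⟶ S.X₃) (hip : i ≫ p = N • 𝟙 _)
    (Y : C) (n : ℕ) :
    Nonempty (((Ext R C (n + 1)).obj (Opposite.op S.X₃)).obj Y ≅
      ((Ext R C (n + 1 + 2)).obj (Opposite.op S.X₃)).obj Y) := by
  let F := extRightOp R Y (n + 2)
  have hF : F.Additive := inferInstanceAs (extRightOp R Y (n + 2)).Additive
  let eT : ((Ext R C (n + 2)).obj (Opposite.op T.X₃)).obj Y ≅
      ((Ext R C (n + 1)).obj (Opposite.op S.X₃)).obj Y :=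
    extIsoOfShortExact hT Y n ≪≫ ((Ext R C (n + 1)).mapIso e.op.symm).app Y
  let eS : ((Ext R C (n + 3)).obj (Opposite.op S.X₃)).obj Y ≅
      ((Ext R C (n + 2)).obj (Opposite.op S.X₁)).obj Y :=
    extIsoOfShortExact hS Y (n + 1)
  have hA := zsmul_id_eq_zero_of_iso eT.symm (zsmul_id_ext_eq_zero i p hip Y n)
  have hB := zsmul_id_eq_zero_of_iso eS (zsmul_id_ext_eq_zero i p hip Y (n + 2))
  obtain ⟨φ⟩ := nonempty_iso_of_comp_eq_zsmul (F.map f) (F.map g) hmN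
    (by rw [← F.map_comp, hfg, F.map_zsmul, F.map_id])
    (by rw [← F.map_comp, hgf, F.map_zsmul, F.map_id])
    (congrArg Quiver.Hom.op hA) (congrArg Quiver.Hom.op hB)
  exact ⟨eT.symm ≪≫ φ.unop.symm ≪≫ eS.symm⟩

end DimensionShift

/-- A criterion for `2`-periodicity of `Ext` out of the module `ℤ` on which a commutative ring `A`
acts through a ring homomorphism `π : A →+* ℤ`. -/
theorem nonempty_ext_iso_ext_add_two_of_ringHom {A : Type} [CommRing A] (π : A →+* ℤ)
    (Z : ModuleCat.{0} A) (φ : ℤ ≃+ Z) (hφ : ∀ (a : A) (n : ℤ), a • φ n = φ (π a * n))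
    (x e : A) {m N : ℤ} (hmN : IsCoprime m N) (hN : N ≠ 0) (hx : π x = 0)
    (hdvd : ∀ a, π a = 0 → x ∣ m * a) (hinj : ∀ a, a * x = 0 → π a = 0 → a = 0)
    (hex : e * x = 0) (heN : π e = N) (Y : ModuleCat.{0} A) (n : ℕ) :
    Nonempty (((Ext A (ModuleCat A) (n + 1)).obj (Opposite.op Z)).obj Y ≅
      ((Ext A (ModuleCat A) (n + 1 + 2)).obj (Opposite.op Z)).obj Y) := by
  let ρ : A →ₗ[A] Z := LinearMap.toSpanSingleton A Z (φ 1)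
  have hρ (a : A) : ρ a = φ (π a) := by
    rw [LinearMap.toSpanSingleton_apply, hφ, mul_one]
  have hρ_surj : Function.Surjective ρ := fun z =>
    ⟨(φ.symm z : ℤ), by rw [hρ, map_intCast, Int.cast_id, φ.apply_symm_apply]⟩
  have hρ_ker (a : A) : a ∈ LinearMap.ker ρ ↔ π a = 0 := by
    rw [LinearMap.mem_ker, hρ, map_eq_zero_iff _ φ.injective]
  let μ : A →ₗ[A] A := LinearMap.toSpanSingleton A A x
  have hμ (a : A) : μ a = a * x := LinearMap.toSpanSingleton_apply _ _ _ _
  have hμ_ker (a : A) : a ∈ LinearMap.ker μ.rangeRestrict ↔ a * x = 0 := by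
    rw [LinearMap.ker_rangeRestrict, LinearMap.mem_ker, hμ]
  -- a generator of the annihilator of `x`
  obtain ⟨d, hd⟩ := IsPrincipalIdealRing.principal
    (Ideal.map π (LinearMap.ker μ.rangeRestrict : Ideal A))
  have hπ_surj : Function.Surjective π := fun k => ⟨k, by simp⟩
  have hmem (k : ℤ) : (∃ a, a * x = 0 ∧ π a = k) ↔ d ∣ k := by
    rw [← Ideal.mem_span_singleton, Ideal.span, ← hd, Ideal.mem_map_iff_of_surjective π hπ_surj]
    simp only [hμ_ker]
  obtain ⟨e₀, he₀x, he₀⟩ := (hmem d).2 dvd_rfl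
  have hd0 : d ≠ 0 := by
    rintro rfl
    exact hN (zero_dvd_iff.1 ((hmem N).1 ⟨e, hex, heN⟩))
  have hsmul (a : A) (k : ℤ) (b : A) (hb : b * x = 0) : a * (k • b) = (π a * k) • b := by
    rw [← sub_eq_zero]
    apply hinj
    · simp only [zsmul_eq_mul]
      linear_combination (a * k - (π a * k : ℤ)) * hb
    · simp [mul_assoc]
  let ε : Z →ₗ[A] LinearMap.ker μ.rangeRestrict :=
    { toFun z := ⟨φ.symm z • e₀, by rw [hμ_ker, smul_mul_assoc, he₀x, smul_zero]⟩
      map_add' z w := Subtype.ext (by simp [add_smul])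
      map_smul' a z := Subtype.ext (by
        obtain ⟨k, rfl⟩ := φ.surjective z
        simp only [hφ, φ.symm_apply_apply, RingHom.id_apply, SetLike.val_smul, smul_eq_mul,
          hsmul a k e₀ he₀x]) }
  have hε : Function.Bijective ε := by
    constructor
    · rw [injective_iff_map_eq_zero]
      intro z hz
      have h1 : φ.symm z • e₀ = 0 := congrArg Subtype.val hz
      have h2 : φ.symm z * d = 0 := by
        simpa [he₀] using congrArg π h1
      exact (map_eq_zero_iff _ φ.symm.injective).1 ((mul_eq_zero.1 h2).resolve_right hd0)
    · rintro ⟨a, ha⟩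
      rw [hμ_ker] at ha
      obtain ⟨k, hk⟩ := (hmem (π a)).1 ⟨a, ha, rfl⟩
      refine ⟨φ k, Subtype.ext ?_⟩
      change φ.symm (φ k) • e₀ = a
      rw [φ.symm_apply_apply, ← sub_eq_zero]
      apply hinj
      · rw [sub_mul, ha, smul_mul_assoc, he₀x, smul_zero, sub_zero]
      · simp [he₀, hk, mul_comm]
  let i : Z →ₗ[A] A :=
    { toFun z := φ.symm z • e
      map_add' z w := by simp [add_smul]
      map_smul' a z := by
        obtain ⟨k, rfl⟩ := φ.surjective z
        simp only [hφ, φ.symm_apply_apply, RingHom.id_apply, smul_eq_mul, hsmul a k e hex] }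
  let f : LinearMap.range μ →ₗ[A] LinearMap.ker ρ :=
    Submodule.inclusion (by
      rintro _ ⟨a, rfl⟩
      rw [hρ_ker, hμ, map_mul, hx, mul_zero])
  let g : LinearMap.ker ρ →ₗ[A] LinearMap.range μ :=
    (((m : A) • LinearMap.id (R := A) (M := A)).comp (LinearMap.ker ρ).subtype).codRestrict _ (by
      rintro ⟨a, ha⟩
      obtain ⟨b, hb⟩ := hdvd a ((hρ_ker a).1 ha)
      exact ⟨b, by rw [hμ, mul_comm, ← hb]; rfl⟩)
  have hS := LinearMap.shortExact_shortComplexKer hρ_surj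
  have hT := LinearMap.shortExact_shortComplexKer μ.surjective_rangeRestrict
  have hP : Projective (ModuleCat.of A A) := (IsProjective.iff_projective A).1 inferInstance
  have : Projective ρ.shortComplexKer.X₂ := hP
  have : Projective μ.rangeRestrict.shortComplexKer.X₂ := hP
  refine nonempty_ext_iso_ext_add_two hS hT
    (LinearEquiv.ofBijective ε hε).symm.toModuleIso (ModuleCat.ofHom f) (ModuleCat.ofHom g) hmN
    ?_ ?_ (P := ModuleCat.of A A) (ModuleCat.ofHom i) (ModuleCat.ofHom ρ) ?_ Y n
  · ext ⟨a, ha⟩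
    change (m : A) * a = ((m • (⟨a, ha⟩ : LinearMap.range μ) : LinearMap.range μ) : A)
    simp
  · ext ⟨a, ha⟩
    change (m : A) * a = ((m • (⟨a, ha⟩ : LinearMap.ker ρ) : LinearMap.ker ρ) : A)
    simp
  · ext z
    change ρ (φ.symm z • e) = N • z
    rw [hρ, map_zsmul, heN, map_zsmul]
    obtain ⟨k, rfl⟩ := φ.surjective z
    rw [φ.symm_apply_apply, ← map_zsmul, ← map_zsmul]
    congr 1
    simp [mul_comm]

section GroupTheory

open scoped Pointwise

variable {G : Type*} [Group G]

/-- `K` is a normal subgroup of index `p` in `L`. -/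
structure IsNormalStep (p : ℕ) (K L : Subgroup G) : Prop where
  le : K ≤ L
  conj_smul : ∀ l ∈ L, MulAut.conj l • K = K
  relIndex_eq : K.relIndex L = p

namespace IsNormalStep

variable {p : ℕ} {K L : Subgroup G}

lemma normal (h : IsNormalStep p K L) : (K.subgroupOf L).Normal where
  conj_mem n hn g := by
    rw [Subgroup.mem_subgroupOf] at hn ⊢
    rw [← h.conj_smul g g.2]
    exact Subgroup.smul_mem_pointwise_smul (n : G) (MulAut.conj (g : G)) K hn

lemma smul (h : IsNormalStep p K L) (g : G) :
    IsNormalStep p (MulAut.conj g • K) (MulAut.conj g • L) where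
  le := Subgroup.pointwise_smul_le_pointwise_smul_iff.2 h.le
  conj_smul := by
    rintro _ ⟨l, hl, rfl⟩
    change MulAut.conj (g * l * g⁻¹) • MulAut.conj g • K = _
    rw [smul_smul, ← map_mul, inv_mul_cancel_right, map_mul, mul_smul, h.conj_smul l hl]
  relIndex_eq := by rw [Subgroup.relIndex_pointwise_smul, h.relIndex_eq]

lemma card_mul (h : IsNormalStep p K L) : Nat.card K * p = Nat.card L := by
  rw [← h.relIndex_eq, ← Subgroup.relIndex_bot_left K, ← Subgroup.relIndex_bot_left L,
    Subgroup.relIndex_mul_relIndex _ _ _ bot_le h.le]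

lemma dvd_card (h : IsNormalStep p K L) : p ∣ Nat.card L :=
  ⟨Nat.card K, by rw [mul_comm, h.card_mul]⟩

lemma dvd_card_group (h : IsNormalStep p K L) : p ∣ Nat.card G :=
  h.dvd_card.trans (Subgroup.card_subgroup_dvd_card L)

lemma not_dvd_card (hG : Squarefree (Nat.card G)) (hp : p.Prime) (h : IsNormalStep p K L) :
    ¬ p ∣ Nat.card K := fun hdvd =>
  hp.one_lt.ne' <| Nat.isUnit_iff.1 <| hG p <|
    ((mul_dvd_mul_right hdvd p).trans h.card_mul.dvd).trans (Subgroup.card_subgroup_dvd_card L)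

lemma pow_mem (h : IsNormalStep p K L) {g : G} (hg : g ∈ L) : g ^ p ∈ K := by
  have := h.normal
  have h1 := Subgroup.pow_index_mem (K.subgroupOf L) ⟨g, hg⟩
  rw [Subgroup.mem_subgroupOf] at h1
  rw [← h.relIndex_eq]
  exact h1

lemma le_of_step (hG : Squarefree (Nat.card G)) (hp : p.Prime) {K' : Subgroup G}
    (h : IsNormalStep p K L) (h' : IsNormalStep p K' L) : K ≤ K' := by
  intro g hg
  have hco : (p : ℤ).gcd (Nat.card K) = 1 :=
    (Nat.Prime.coprime_iff_not_dvd hp).2 (h.not_dvd_card hG hp)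
  have h1 : g ^ Nat.card K = 1 := by
    exact congrArg Subtype.val (pow_card_eq_one' (x := (⟨g, hg⟩ : K)))
  obtain ⟨s, t, hst⟩ := Int.isCoprime_iff_gcd_eq_one.2 hco
  have h2 : g = (g ^ p) ^ s * (g ^ Nat.card K) ^ t := by
    rw [← zpow_natCast, ← zpow_natCast, ← zpow_mul, ← zpow_mul, ← zpow_add, mul_comm (p : ℤ),
      mul_comm (Nat.card K : ℤ), hst, zpow_one]
  rw [h2, h1, one_zpow, mul_one]
  exact K'.zpow_mem (h'.pow_mem (h.le hg)) s

lemma lower_unique (hG : Squarefree (Nat.card G)) (hp : p.Prime) {K' : Subgroup G}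
    (h : IsNormalStep p K L) (h' : IsNormalStep p K' L) : K = K' :=
  le_antisymm (h.le_of_step hG hp h') (h'.le_of_step hG hp h)

lemma eq_of_lt_of_le (hp : p.Prime) (h : IsNormalStep p K L) {M : Subgroup G} (h1 : K < M)
    (h2 : M ≤ L) : M = L := by
  have h3 := Subgroup.relIndex_mul_relIndex _ _ _ h1.le h2
  rw [h.relIndex_eq] at h3
  rcases (Nat.dvd_prime hp).1 ⟨_, h3.symm⟩ with h4 | h4
  · exact absurd (Subgroup.relIndex_eq_one.1 h4) h1.not_ge
  · rw [h4] at h3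
    exact le_antisymm h2
      (Subgroup.relIndex_eq_one.1 (Nat.eq_of_mul_eq_mul_left hp.pos (h3.trans (mul_one p).symm)))

lemma upper_conj [Finite G] (hG : Squarefree (Nat.card G)) (hp : p.Prime) {L' : Subgroup G}
    (h : IsNormalStep p K L) (h' : IsNormalStep p K L') : ∃ g : G, MulAut.conj g • L = L' := by
  have : Fact p.Prime := ⟨hp⟩
  let M : Subgroup G := Subgroup.normalizer (K : Set G)
  have hM {l : G} (hl : MulAut.conj l • K = K) : l ∈ M := by
    rw [Subgroup.mem_normalizer_iff]
    intro k
    conv_rhs => rw [← hl]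
    exact (Subgroup.smul_mem_pointwise_smul_iff (a := MulAut.conj l)).symm
  have hM' {l : G} (hl : l ∈ M) : MulAut.conj l • K = K := by
    ext k
    rw [Subgroup.mem_pointwise_smul_iff_inv_smul_mem, ← map_inv]
    exact ((Subgroup.mem_normalizer_iff.1 (M.inv_mem hl)) k).symm
  have hfac : (Nat.card M).factorization p ≤ 1 :=
    (hG.squarefree_of_dvd (Subgroup.card_subgroup_dvd_card M)).natFactorization_le_one p
  have key {L : Subgroup G} (h : IsNormalStep p K L) :
      ∃ a : M, (a : G) ∈ L ∧ orderOf a = p ∧ ∃ P : Sylow p M, (P : Subgroup M) = .zpowers a := by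
    obtain ⟨⟨a, haL⟩, ha⟩ := exists_prime_orderOf_dvd_card' p h.dvd_card
    rw [Subgroup.orderOf_mk] at ha
    have ha' : orderOf (⟨a, hM (h.conj_smul a haL)⟩ : M) = p := by rwa [Subgroup.orderOf_mk]
    refine ⟨⟨a, hM (h.conj_smul a haL)⟩, haL, ha', Sylow.ofCard (.zpowers _) ?_, rfl⟩
    rw [Nat.card_zpowers, ha']
    have h1 : (Nat.card M).factorization p = 1 := by
      refine le_antisymm hfac ((hp.dvd_iff_one_le_factorization Nat.card_pos.ne').1 ?_)
      rw [← ha']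
      exact orderOf_dvd_natCard _
    rw [h1, pow_one]
  obtain ⟨a, haL, ha, P, hP⟩ := key h
  obtain ⟨b, hbL, hb, Q, hQ⟩ := key h'
  obtain ⟨g, hg⟩ := MulAction.exists_smul_eq M P Q
  refine ⟨g, ?_⟩
  have hstep : IsNormalStep p K (MulAut.conj (g : G) • L) := by
    have := h.smul (g : G)
    rwa [hM' g.2] at this
  have hmem : g * a * g⁻¹ ∈ Subgroup.zpowers b := by
    rw [← hQ, ← hg, Sylow.coe_subgroup_smul, hP]
    exact Subgroup.smul_mem_pointwise_smul a (MulAut.conj g) _ (Subgroup.mem_zpowers a)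
  have hc1 : ((g * a * g⁻¹ : M) : G) ∈ MulAut.conj (g : G) • L :=
    Subgroup.smul_mem_pointwise_smul (a : G) (MulAut.conj (g : G)) L haL
  have hc2 : ((g * a * g⁻¹ : M) : G) ∈ L' := by
    obtain ⟨k, hk⟩ := hmem
    rw [← hk]
    exact L'.zpow_mem hbL k
  have hcK : ((g * a * g⁻¹ : M) : G) ∉ K := by
    intro hc
    apply h.not_dvd_card hG hp
    have h1 : orderOf ((g * a * g⁻¹ : M) : G) = p := by
      rw [Subgroup.orderOf_coe, ← ha]
      exact orderOf_injective (MulAut.conj g).toMonoidHom (MulAut.conj g).injective a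
    rw [← h1, ← Subgroup.orderOf_mk _ hc]
    exact orderOf_dvd_natCard _
  have hlt : K < MulAut.conj (g : G) • L ⊓ L' :=
    lt_of_le_of_ne (le_inf hstep.le h'.le) fun heq => hcK (heq ▸ ⟨hc1, hc2⟩)
  rw [← hstep.eq_of_lt_of_le hp hlt inf_le_left, h'.eq_of_lt_of_le hp hlt inf_le_right]

end IsNormalStep

lemma exists_isNormalStep [Finite G] {p : ℕ} (hp : p.Prime) (L : Subgroup G)
    (hdvd : p ∣ Nat.card (MulAction.fixedPoints L (G ⧸ L))) : ∃ L', IsNormalStep p L L' := by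
  have : Fact p.Prime := ⟨hp⟩
  rw [Nat.card_congr (Sylow.fixedPointsMulLeftCosetsEquivQuotient L)] at hdvd
  let M : Subgroup G := Subgroup.normalizer (L : Set G)
  let f : M →* M ⧸ L.subgroupOf M := QuotientGroup.mk' (L.subgroupOf M)
  obtain ⟨x, hx⟩ := exists_prime_orderOf_dvd_card' (G := M ⧸ L.subgroupOf M) p hdvd
  have hker : (⊥ : Subgroup _).comap f = L.subgroupOf M := QuotientGroup.ker_mk' _
  refine ⟨((Subgroup.zpowers x).comap f).map M.subtype, ?_, ?_, ?_⟩
  · intro l hl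
    refine ⟨⟨l, Subgroup.le_normalizer hl⟩, ?_, rfl⟩
    exact (hker.ge.trans (Subgroup.comap_mono bot_le)) hl
  · rintro _ ⟨l, -, rfl⟩
    ext k
    rw [Subgroup.mem_pointwise_smul_iff_inv_smul_mem, ← map_inv]
    exact ((Subgroup.mem_normalizer_iff.1 (M.inv_mem l.2)) k).symm
  · rw [← Subgroup.relIndex_comap]
    change (L.subgroupOf M).relIndex _ = p
    refine (congrArg (fun T => Subgroup.relIndex T ((Subgroup.zpowers x).comap f))
      hker).symm.trans ?_
    rw [Subgroup.relIndex_comap, Subgroup.map_comap_eq_self_of_surjective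
      (QuotientGroup.mk'_surjective _), Subgroup.relIndex_bot_left, Nat.card_zpowers, hx]

end GroupTheory

section Burnside

open scoped Pointwise

open MulAction

variable {G : Type} [Group G]

lemma mem_fixedPoints_subgroup {X : Type*} [MulAction G X] {K : Subgroup G} {x : X} :
    x ∈ fixedPoints K X ↔ ∀ k ∈ K, k • x = x :=
  ⟨fun h k hk => h ⟨k, hk⟩, fun h k => h k k.2⟩

lemma card_fixedPoints_conj_smul (X : Type*) [MulAction G X] (g : G) (K : Subgroup G) :
    Nat.card (fixedPoints (MulAut.conj g • K : Subgroup G) X) = Nat.card (fixedPoints K X) := by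
  refine Nat.card_congr ((MulAction.toPerm g⁻¹).subtypeEquiv fun x => ?_)
  rw [mem_fixedPoints_subgroup, mem_fixedPoints_subgroup]
  constructor
  · intro h k hk
    have := h (g * k * g⁻¹) (Subgroup.smul_mem_pointwise_smul k (MulAut.conj g) K hk)
    rw [mul_smul, mul_smul, smul_eq_iff_eq_inv_smul] at this
    exact this
  · rintro h _ ⟨k, hk, rfl⟩
    have := h k hk
    change (g * k * g⁻¹) • x = x
    rw [mul_smul, mul_smul, smul_eq_iff_eq_inv_smul]
    exact this

lemma IsNormalStep.card_fixedPoints_modEq {p : ℕ} (hp : p.Prime) {K L : Subgroup G}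
    (h : IsNormalStep p K L) (X : Type*) [Finite X] [MulAction G X] :
    Nat.card (fixedPoints K X) ≡ Nat.card (fixedPoints L X) [MOD p] := by
  have : Fact p.Prime := ⟨hp⟩
  have := h.normal
  have hP : IsPGroup p (L ⧸ K.subgroupOf L) := IsPGroup.of_card (n := 1) <| by
    rw [pow_one]
    exact h.relIndex_eq
  have h1 := hP.card_modEq_card_fixedPoints (fixedPoints (K.subgroupOf L) X)
  have hK : Nat.card (fixedPoints (K.subgroupOf L) X) = Nat.card (fixedPoints K X) := by
    refine Nat.card_congr (Equiv.setCongr ?_)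
    ext x
    rw [mem_fixedPoints_subgroup, mem_fixedPoints_subgroup]
    exact ⟨fun h' k hk => h' ⟨k, h.le hk⟩ hk, fun h' k hk => h' k hk⟩
  rw [hK] at h1
  refine h1.trans (congrArg (· % p) (Nat.card_congr ?_))
  refine
    { toFun := fun x => ⟨x.1.1, fun l => congrArg Subtype.val (x.2 (l : L ⧸ K.subgroupOf L))⟩
      invFun := fun x => ⟨⟨x.1, fun k => x.2 k.1⟩, fun q => ?_⟩
      left_inv := fun _ => rfl
      right_inv := fun _ => rfl }
  induction q using QuotientGroup.induction_on with
  | H l => exact Subtype.ext (x.2 l)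

/-- The vectors of integers indexed by the subgroups of `G` which are constant on conjugacy classes
and satisfy the congruences modulo `p` between the entries of subgroups `K ⊴ L` of index `p`. -/
def congruenceSubring (G : Type) [Group G] : Subring (Subgroup G → ℤ) where
  carrier := {f | (∀ (g : G) K, f (MulAut.conj g • K) = f K) ∧
    ∀ (p : ℕ), p.Prime → ∀ K L, IsNormalStep p K L → (p : ℤ) ∣ f K - f L}
  mul_mem' {a b} ha hb := ⟨fun g K => by rw [Pi.mul_apply, ha.1, hb.1, Pi.mul_apply],
    fun p hp K L h => by
      have h1 : (a * b) K - (a * b) L = (a K - a L) * b K + a L * (b K - b L) := by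
        simp only [Pi.mul_apply]
        ring
      rw [h1]
      exact dvd_add ((ha.2 p hp K L h).mul_right _) ((hb.2 p hp K L h).mul_left _)⟩
  one_mem' := ⟨fun _ _ => rfl, fun p _ K L _ => by simp⟩
  add_mem' {a b} ha hb := ⟨fun g K => by rw [Pi.add_apply, ha.1, hb.1, Pi.add_apply],
    fun p hp K L h => by
      have h1 : (a + b) K - (a + b) L = (a K - a L) + (b K - b L) := by
        simp only [Pi.add_apply]
        ring
      rw [h1]
      exact dvd_add (ha.2 p hp K L h) (hb.2 p hp K L h)⟩
  zero_mem' := ⟨fun _ _ => rfl, fun p _ K L _ => by simp⟩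
  neg_mem' {a} ha := ⟨fun g K => by rw [Pi.neg_apply, ha.1, Pi.neg_apply],
    fun p hp K L h => by
      have h1 : (-a) K - (-a) L = -(a K - a L) := by
        simp only [Pi.neg_apply]
        ring
      rw [h1]
      exact (ha.2 p hp K L h).neg_right⟩

lemma burnsideRing_le_congruenceSubring : burnsideRing G ≤ congruenceSubring G := by
  refine Subring.closure_le.2 ?_
  rintro _ ⟨X, _, _, rfl⟩
  refine ⟨fun g K => congrArg _ (card_fixedPoints_conj_smul X g K), fun p hp K L h => ?_⟩
  exact (Nat.modEq_iff_dvd.1 (h.card_fixedPoints_modEq hp X).symm)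

/-- The mark vector of the transitive `G`-set `G ⧸ L`. -/
def cosetMark (L : Subgroup G) (K : Subgroup G) : ℤ := Nat.card (fixedPoints K (G ⧸ L))

lemma cosetMark_mem [Finite G] (L : Subgroup G) : cosetMark L ∈ burnsideRing G :=
  Subring.subset_closure ⟨G ⧸ L, Fintype.ofFinite _, inferInstance, rfl⟩

lemma exists_le_conj_of_cosetMark_ne_zero {K L : Subgroup G} (h : cosetMark L K ≠ 0) :
    ∃ g : G, K ≤ MulAut.conj g • L := by
  have h1 : Nat.card (fixedPoints K (G ⧸ L)) ≠ 0 := fun h0 => h (by rw [cosetMark, h0]; rfl)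
  obtain ⟨⟨x, hx⟩⟩ := (Nat.card_ne_zero.1 h1).1
  induction x using QuotientGroup.induction_on with
  | H g =>
    refine ⟨g, fun k hk => ?_⟩
    have h2 : ((k * g : G) : G ⧸ L) = (g : G ⧸ L) := hx ⟨k, hk⟩
    rw [eq_comm, QuotientGroup.eq] at h2
    rw [Subgroup.mem_pointwise_smul_iff_inv_smul_mem, ← map_inv]
    change g⁻¹ * k * g⁻¹⁻¹ ∈ L
    rwa [inv_inv, mul_assoc]

lemma card_fixedPoints_coset_self_dvd [Finite G] (L : Subgroup G) :
    Nat.card (fixedPoints L (G ⧸ L)) ∣ Nat.card G := by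
  rw [Nat.card_congr (Sylow.fixedPointsMulLeftCosetsEquivQuotient L)]
  exact (Subgroup.card_quotient_dvd_card _).trans (Subgroup.card_subgroup_dvd_card _)

lemma Squarefree.natCast_dvd_of_forall_prime {w : ℕ} (hw : Squarefree w) {a : ℤ}
    (h : ∀ p : ℕ, p.Prime → p ∣ w → (p : ℤ) ∣ a) : (w : ℤ) ∣ a := by
  rw [Int.natCast_dvd, ← Nat.prod_primeFactors_of_squarefree hw]
  exact Finset.prod_primes_dvd _ (fun p hp => (Nat.prime_of_mem_primeFactors hp).prime) fun p hp =>
    Int.natCast_dvd.1 (h p (Nat.prime_of_mem_primeFactors hp) (Nat.dvd_of_mem_primeFactors hp))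

lemma congruenceSubring_le_burnsideRing [Finite G] (hG : Squarefree (Nat.card G)) :
    congruenceSubring G ≤ burnsideRing G := by
  classical
  have := Fintype.ofFinite (Subgroup G)
  suffices H : ∀ (n : ℕ) (f : Subgroup G → ℤ), f ∈ congruenceSubring G →
      (Finset.univ.filter fun K => ∃ K', K ≤ K' ∧ f K' ≠ 0).card = n → f ∈ burnsideRing G from
    fun f hf => H _ f hf rfl
  intro n
  induction n using Nat.strong_induction_on with
  | _ n ih =>
  intro f hf hn
  by_cases h0 : f = 0
  · rw [h0]
    exact zero_mem _
  obtain ⟨L₀, hL₀⟩ := Function.ne_iff.1 h0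
  obtain ⟨L, hL, hmax⟩ := (Finset.univ.filter fun K => f K ≠ 0).exists_max_image
    (fun K => Nat.card K) ⟨L₀, by simpa using hL₀⟩
  simp only [Finset.mem_filter, Finset.mem_univ, true_and] at hL hmax
  have hw : Nat.card (fixedPoints L (G ⧸ L)) ∣ Nat.card G := card_fixedPoints_coset_self_dvd L
  have hdvd : (Nat.card (fixedPoints L (G ⧸ L)) : ℤ) ∣ f L := by
    refine Squarefree.natCast_dvd_of_forall_prime (hG.squarefree_of_dvd hw) fun p hp hpw => ?_
    obtain ⟨L', hL'⟩ := exists_isNormalStep hp L hpw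
    have h2 : f L' = 0 := by
      by_contra h2
      have h3 := hmax L' h2
      rw [← hL'.card_mul] at h3
      exact h3.not_gt (lt_mul_of_one_lt_right Nat.card_pos hp.one_lt)
    simpa [h2] using hf.2 p hp L L' hL'
  obtain ⟨c, hc⟩ := hdvd
  have hcmem : c • cosetMark L ∈ burnsideRing G := zsmul_mem (cosetMark_mem L) c
  have hsub : f - c • cosetMark L ∈ burnsideRing G := by
    refine ih _ ?_ _ (sub_mem hf (burnsideRing_le_congruenceSubring hcmem)) rfl
    rw [← hn]
    refine Finset.card_lt_card (Finset.ssubset_iff_of_subset ?_ |>.2 ⟨L, ?_, ?_⟩)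
    · intro K hK
      simp only [Finset.mem_filter, Finset.mem_univ, true_and, Pi.sub_apply, Pi.smul_apply] at hK ⊢
      obtain ⟨K', hKK', h1⟩ := hK
      by_cases h2 : f K' = 0
      · rw [h2, zero_sub, neg_ne_zero] at h1
        obtain ⟨g, hg⟩ := exists_le_conj_of_cosetMark_ne_zero (right_ne_zero_of_smul h1)
        exact ⟨_, hKK'.trans hg, by rwa [hf.1]⟩
      · exact ⟨K', hKK', h2⟩
    · simpa using ⟨L, le_rfl, hL⟩
    · simp only [Finset.mem_filter, Finset.mem_univ, true_and, not_exists, not_and, not_not]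
      intro K' hK'
      rcases hK'.eq_or_lt with rfl | hlt
      · rw [Pi.sub_apply, hc, Pi.smul_apply, smul_eq_mul, cosetMark, mul_comm, sub_self]
      · have h1 : Nat.card L < Nat.card K' := Set.ncard_lt_ncard hlt
        have h2 : f K' = 0 := by
          by_contra h2
          exact (hmax K' h2).not_gt h1
        have h3 : cosetMark L K' = 0 := by
          by_contra h3
          obtain ⟨g, hg⟩ := exists_le_conj_of_cosetMark_ne_zero h3
          have h4 := Subgroup.card_le_of_le hg
          rw [Nat.card_congr (Subgroup.equivSMul (MulAut.conj g) L).symm.toEquiv] at h4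
          exact h4.not_gt h1
        rw [Pi.sub_apply, h2, Pi.smul_apply, h3, smul_zero, sub_zero]
  have := add_mem hsub hcmem
  rwa [sub_add_cancel] at this

end Burnside

section Core

open scoped Pointwise

variable {G : Type*} [Group G]

open Classical in
/-- The normal subgroup of index `p` of `L` if there is one, and `L` otherwise. -/
def primeCore (p : ℕ) (L : Subgroup G) : Subgroup G :=
  if h : ∃ K, IsNormalStep p K L then h.choose else L

lemma primeCore_eq_or (p : ℕ) (L : Subgroup G) :
    primeCore p L = L ∨ IsNormalStep p (primeCore p L) L := by
  by_cases h : ∃ K, IsNormalStep p K L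
  · rw [primeCore, dif_pos h]
    exact Or.inr h.choose_spec
  · exact Or.inl (dif_neg h)

variable {p : ℕ} {K L H : Subgroup G}

namespace IsNormalStep

lemma primeCore_right (hG : Squarefree (Nat.card G)) (hp : p.Prime) (h : IsNormalStep p K L) :
    primeCore p L = K := by
  have h' : ∃ K, IsNormalStep p K L := ⟨K, h⟩
  rw [primeCore, dif_pos h']
  exact h'.choose_spec.lower_unique hG hp h

lemma primeCore_left (hG : Squarefree (Nat.card G)) (hp : p.Prime) (h : IsNormalStep p K L) :
    primeCore p K = K :=
  dif_neg fun ⟨_, h'⟩ => h.not_dvd_card hG hp h'.dvd_card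

end IsNormalStep

lemma primeCore_conj_smul (hG : Squarefree (Nat.card G)) (hp : p.Prime) (g : G)
    (L : Subgroup G) : primeCore p (MulAut.conj g • L) = MulAut.conj g • primeCore p L := by
  by_cases h : ∃ K, IsNormalStep p K L
  · obtain ⟨K, h⟩ := h
    rw [(h.smul g).primeCore_right hG hp, h.primeCore_right hG hp]
  · have h1 : ¬ ∃ K, IsNormalStep p K (MulAut.conj g • L) := by
      rintro ⟨K, hK⟩
      refine h ⟨MulAut.conj g⁻¹ • K, ?_⟩
      simpa only [smul_smul, ← map_mul, inv_mul_cancel, map_one, one_smul] using hK.smul g⁻¹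
    rw [primeCore, dif_neg h1, primeCore, dif_neg h]

/-- `K` is a conjugate of `H`. -/
def IsConjTo (H K : Subgroup G) : Prop := ∃ g : G, MulAut.conj g • K = H

lemma IsConjTo.refl (H : Subgroup G) : IsConjTo H H := ⟨1, by rw [map_one, one_smul]⟩

lemma isConjTo_conj_smul (g : G) : IsConjTo H (MulAut.conj g • K) ↔ IsConjTo H K := by
  constructor
  · rintro ⟨x, hx⟩
    exact ⟨x * g, by rw [map_mul, mul_smul, hx]⟩
  · rintro ⟨x, hx⟩
    refine ⟨x * g⁻¹, ?_⟩
    rw [smul_smul, ← map_mul, inv_mul_cancel_right, hx]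

lemma IsConjTo.symm (h : IsConjTo H K) : IsConjTo K H := by
  obtain ⟨g, rfl⟩ := h
  exact ⟨g⁻¹, by rw [smul_smul, ← map_mul, inv_mul_cancel, map_one, one_smul]⟩

lemma IsConjTo.trans {M : Subgroup G} (h : IsConjTo H K) (h' : IsConjTo K M) : IsConjTo H M := by
  obtain ⟨g, rfl⟩ := h'
  exact (isConjTo_conj_smul g).1 h

/-- `K` lies in the same block of subgroups at `p` as `H`. -/
def InBlock (p : ℕ) (H K : Subgroup G) : Prop := IsConjTo (primeCore p H) (primeCore p K)

lemma inBlock_conj_smul (hG : Squarefree (Nat.card G)) (hp : p.Prime) (g : G) :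
    InBlock p H (MulAut.conj g • K) ↔ InBlock p H K := by
  rw [InBlock, primeCore_conj_smul hG hp, isConjTo_conj_smul, InBlock]

lemma IsConjTo.inBlock (hG : Squarefree (Nat.card G)) (hp : p.Prime) (h : IsConjTo H K) :
    InBlock p H K := by
  obtain ⟨g, rfl⟩ := h
  exact ⟨g, (primeCore_conj_smul hG hp g K).symm⟩

lemma IsNormalStep.inBlock_iff (hG : Squarefree (Nat.card G)) (hp : p.Prime)
    (h : IsNormalStep p K L) : InBlock p H K ↔ InBlock p H L := by
  rw [InBlock, InBlock, h.primeCore_left hG hp, h.primeCore_right hG hp]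

/-- Up to conjugacy a block contains at most one other subgroup. -/
lemma InBlock.isConjTo [Finite G] (hG : Squarefree (Nat.card G)) (hp : p.Prime)
    (hK : InBlock p H K) (hL : InBlock p H L) (hK' : ¬ IsConjTo H K) (hL' : ¬ IsConjTo H L) :
    IsConjTo K L := by
  rcases primeCore_eq_or p H with hH | hH
  · have key {K : Subgroup G} (hK : InBlock p H K) (hK' : ¬ IsConjTo H K) :
        ∃ g : G, IsNormalStep p H (MulAut.conj g • K) := by
      rw [InBlock, hH] at hK
      rcases primeCore_eq_or p K with h | h
      · exact absurd (h ▸ hK) hK'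
      · obtain ⟨g, hg⟩ := hK
        exact ⟨g, hg ▸ h.smul g⟩
    obtain ⟨g, hg⟩ := key hK hK'
    obtain ⟨k, hk⟩ := key hL hL'
    obtain ⟨x, hx⟩ := hk.upper_conj hG hp hg
    have h1 : IsConjTo (MulAut.conj g • K) L := (isConjTo_conj_smul k).1 ⟨x, hx⟩
    exact ((isConjTo_conj_smul g).1 h1.symm).symm
  · have key {K : Subgroup G} (hK : InBlock p H K) (hK' : ¬ IsConjTo H K) :
        IsConjTo (primeCore p H) K := by
      rcases primeCore_eq_or p K with h | h
      · exact h ▸ hK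
      · obtain ⟨g, hg⟩ := hK
        have h1 := h.smul g
        rw [hg] at h1
        obtain ⟨x, hx⟩ := h1.upper_conj hG hp hH
        exact absurd ((isConjTo_conj_smul g).1 ⟨x, hx⟩) hK'
    exact (key hK hK').symm.trans (key hL hL')

end Core

section Combine

lemma dvd_div_of_ne {N p q : ℕ} (hp : p.Prime) (hq : q.Prime) (hpq : p ≠ q) (hpN : p ∣ N)
    (hqN : q ∣ N) : q ∣ N / p := by
  refine ((Nat.coprime_primes hq hp).2 hpq.symm).dvd_of_dvd_mul_right (n := p) ?_
  rwa [Nat.div_mul_cancel hpN]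

/-- An ideal which is principal locally at every prime divisor of a square-free integer `N` is
principal up to a factor prime to `N`. -/
lemma exists_isCoprime_forall_sum_dvd {A : Type*} [CommRing A] [IsNoetherian ℤ A] (I : Ideal A)
    {N : ℕ} (hN : Squarefree N) (z : ℕ → A) (hz : ∀ p ∈ N.primeFactors, z p ∈ I)
    (hdvd : ∀ p ∈ N.primeFactors, ∃ r : ℤ, IsCoprime r p ∧ ∀ a ∈ I, z p ∣ (r : A) * a) :
    ∃ m : ℤ, IsCoprime m N ∧
      ∀ a ∈ I, (∑ p ∈ N.primeFactors, ((N / p : ℕ) : A) * z p) ∣ (m : A) * a := by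
  set x : A := ∑ p ∈ N.primeFactors, ((N / p : ℕ) : A) * z p with hx
  let f : A →ₗ[ℤ] A ⧸ Ideal.span {x} :=
    (Ideal.Quotient.mk (Ideal.span {x})).toAddMonoidHom.toIntLinearMap
  have hf (a : A) : f a = 0 ↔ x ∣ a :=
    Ideal.Quotient.eq_zero_iff_mem.trans Ideal.mem_span_singleton
  let Q : Submodule ℤ (A ⧸ Ideal.span {x}) := (I.restrictScalars ℤ).map f
  have hloc : ∀ p ∈ N.primeFactors, ∃ r : ℤ, r - 1 ∈ Ideal.span {(p : ℤ)} ∧ ∀ q ∈ Q, r • q = 0 := by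
    intro p hp
    refine Submodule.exists_sub_one_mem_and_smul_eq_zero_of_fg_of_le_smul _ Q
      ((IsNoetherian.noetherian _).map f) ?_
    rintro _ ⟨a, ha, rfl⟩
    obtain ⟨r, hr, hra⟩ := hdvd p hp
    obtain ⟨b, hb⟩ := hra a ha
    have hpN : p ∣ N := Nat.dvd_of_mem_primeFactors hp
    have hpp : p.Prime := Nat.prime_of_mem_primeFactors hp
    have hcop : IsCoprime (((N / p : ℕ) : ℤ) * r) p := by
      refine IsCoprime.mul_left (Nat.isCoprime_iff_coprime.2 ?_) hr
      refine Nat.coprime_of_squarefree_mul ?_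
      rwa [Nat.div_mul_cancel hpN]
    obtain ⟨u, v, huv⟩ := hcop
    have hq : ∀ q ∈ N.primeFactors.erase p, ∃ i ∈ I, ((N / q : ℕ) : A) * z q = (p : ℤ) • i := by
      intro q hq
      obtain ⟨hqp, hq⟩ := Finset.mem_erase.1 hq
      have hqN : q ∣ N := Nat.dvd_of_mem_primeFactors hq
      obtain ⟨c, hc⟩ := dvd_div_of_ne (Nat.prime_of_mem_primeFactors hq) hpp hqp hqN hpN
      refine ⟨c * z q, I.mul_mem_left _ (hz q hq), ?_⟩
      rw [hc, zsmul_eq_mul]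
      push_cast
      ring
    have hsum : ∃ i ∈ I, ∑ q ∈ N.primeFactors.erase p, ((N / q : ℕ) : A) * z q = (p : ℤ) • i := by
      choose! i hi hi' using hq
      exact ⟨∑ q ∈ N.primeFactors.erase p, i q, I.sum_mem hi,
        by rw [Finset.smul_sum]; exact Finset.sum_congr rfl hi'⟩
    obtain ⟨i, hi, hi'⟩ := hsum
    have hxi : x = ((N / p : ℕ) : A) * z p + (p : ℤ) • i := by
      rw [hx, ← Finset.add_sum_erase _ _ hp, hi']
    have hkey : a = x * (u * b) + (p : ℤ) • (v * a - i * (u * b)) := by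
      have huv' := congrArg (Int.cast : ℤ → A) huv
      simp only [Int.cast_add, Int.cast_mul, Int.cast_natCast, Int.cast_one] at huv'
      rw [zsmul_eq_mul] at hxi ⊢
      push_cast at hxi ⊢
      linear_combination (-a) * huv' - (u * b) * hxi + u * ((N / p : ℕ) : A) * hb
    have hfa : f a = (p : ℤ) • f (v * a - i * (u * b)) := by
      conv_lhs => rw [hkey]
      rw [map_add, (hf _).2 (dvd_mul_right _ _), zero_add, map_smul]
    rw [hfa]
    exact Submodule.smul_mem_smul (Ideal.mem_span_singleton_self _)
      ⟨_, sub_mem (I.mul_mem_left _ ha) (I.mul_mem_right _ hi), rfl⟩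
  obtain ⟨m, hm⟩ := IsPrincipalIdealRing.principal Q.annihilator
  have hmem (r : ℤ) : (∀ q ∈ Q, r • q = 0) ↔ m ∣ r := by
    rw [← Submodule.mem_annihilator, hm]
    exact Ideal.mem_span_singleton
  refine ⟨m, ?_, fun a ha => (hf _).1 ?_⟩
  · rw [Int.isCoprime_iff_gcd_eq_one]
    refine Nat.coprime_of_dvd fun p hp h1 h2 => ?_
    rw [Int.natAbs_natCast] at h2
    obtain ⟨r, hr, hr'⟩ := hloc p (hp.mem_primeFactors h2 hN.ne_zero)
    have h3 : (p : ℤ) ∣ r := (Int.natCast_dvd.2 h1).trans ((hmem r).1 hr')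
    have h4 : (p : ℤ) ∣ 1 := by
      have := dvd_sub h3 (Ideal.mem_span_singleton.1 hr)
      rwa [sub_sub_cancel] at this
    exact hp.one_lt.ne' (by exact_mod_cast Int.eq_one_of_dvd_one (Int.natCast_nonneg p) h4)
  · rw [← zsmul_eq_mul, map_smul]
    exact (hmem m).2 dvd_rfl _ ⟨a, ha, rfl⟩

end Combine

section BlockVector

open scoped Pointwise

variable {G : Type} [Group G]

open Classical in
/-- The vector which is `0` on the conjugates of `H`, `p` on the other subgroups of the block of `H`
at `p`, and `1` elsewhere. -/
def blockVector (p : ℕ) (H K : Subgroup G) : ℤ :=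
  if IsConjTo H K then 0 else if InBlock p H K then p else 1

lemma mem_congruenceSubring_of_block {p : ℕ} (hp : p.Prime) (hpN : p ∣ Nat.card G)
    (f : Subgroup G → ℤ) (hf : ∀ (g : G) K, f (MulAut.conj g • K) = f K)
    (hf' : ∀ K L, IsNormalStep p K L → (p : ℤ) ∣ f K - f L) :
    (fun K => ((Nat.card G / p : ℕ) : ℤ) * f K) ∈ congruenceSubring G := by
  refine ⟨fun g K => congrArg _ (hf g K), fun q hq K L h => ?_⟩
  rw [← mul_sub]
  by_cases hpq : p = q
  · subst hpq
    exact (hf' K L h).mul_left _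
  · exact (Int.natCast_dvd_natCast.2 (dvd_div_of_ne hp hq hpq hpN h.dvd_card_group)).mul_right _

variable {p : ℕ} {H : Subgroup G}

lemma blockVector_mem (hG : Squarefree (Nat.card G)) (hp : p.Prime) (hpN : p ∣ Nat.card G)
    (H : Subgroup G) :
    (fun K => ((Nat.card G / p : ℕ) : ℤ) * blockVector p H K) ∈ congruenceSubring G := by
  refine mem_congruenceSubring_of_block hp hpN _ (fun g K => ?_) fun K L h => ?_
  · classical simp only [blockVector, isConjTo_conj_smul, inBlock_conj_smul hG hp]
  · have key {K : Subgroup G} (hK : InBlock p H K) : (p : ℤ) ∣ blockVector p H K := by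
      rw [blockVector, if_pos hK]
      split_ifs
      exacts [dvd_zero _, dvd_rfl]
    by_cases hK : InBlock p H K
    · exact dvd_sub (key hK) (key ((h.inBlock_iff hG hp).1 hK))
    · have hL : ¬ InBlock p H L := fun hL => hK ((h.inBlock_iff hG hp).2 hL)
      rw [blockVector, blockVector, if_neg fun h => hK (h.inBlock hG hp), if_neg hK,
        if_neg fun h => hL (h.inBlock hG hp), if_neg hL, sub_self]
      exact dvd_zero _

lemma dvd_of_inBlock {a : Subgroup G → ℤ} (ha : a ∈ congruenceSubring G) (hp : p.Prime)
    (haH : a H = 0) {K : Subgroup G} (hK : InBlock p H K) : (p : ℤ) ∣ a K := by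
  have key (K : Subgroup G) : (p : ℤ) ∣ a (primeCore p K) - a K := by
    rcases primeCore_eq_or p K with h | h
    · rw [h, sub_self]
      exact dvd_zero _
    · exact ha.2 p hp _ _ h
  obtain ⟨g, hg⟩ := hK
  have h1 : a (primeCore p H) = a (primeCore p K) := by rw [← hg, ha.1]
  have h2 := dvd_sub (key H) (key K)
  rwa [h1, haH, sub_zero, sub_sub_cancel] at h2

lemma exists_mul_blockVector_eq [Finite G] (hG : Squarefree (Nat.card G)) (hp : p.Prime)
    (hpN : p ∣ Nat.card G) {a : Subgroup G → ℤ} (ha : a ∈ congruenceSubring G) (haH : a H = 0) :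
    ∃ b ∈ congruenceSubring G, ∀ K, ((Nat.card G / p : ℕ) : ℤ) ^ 2 * a K =
      ((Nat.card G / p : ℕ) : ℤ) * blockVector p H K * b K := by
  classical
  obtain ⟨β, hβ⟩ : ∃ β : ℤ, ∀ K, InBlock p H K → ¬ IsConjTo H K → a K = p * β := by
    by_cases h : ∃ K, InBlock p H K ∧ ¬ IsConjTo H K
    · obtain ⟨K, hK, hK'⟩ := h
      obtain ⟨β, hβ⟩ := dvd_of_inBlock ha hp haH hK
      refine ⟨β, fun L hL hL' => ?_⟩
      obtain ⟨g, hg⟩ := hK.isConjTo hG hp hL hK' hL'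
      rw [← hβ, ← hg, ha.1]
    · exact ⟨0, fun K hK hK' => absurd ⟨K, hK, hK'⟩ h⟩
  refine ⟨_, mem_congruenceSubring_of_block hp hpN (fun K => if InBlock p H K then β else a K)
    (fun g K => ?_) fun K L h => ?_, fun K => ?_⟩
  · simp only [inBlock_conj_smul hG hp, ha.1]
  · simp only [h.inBlock_iff hG hp]
    split_ifs
    · rw [sub_self]
      exact dvd_zero _
    · exact ha.2 p hp K L h
  · rw [blockVector]
    split_ifs with h1 h2 h2
    · obtain ⟨g, rfl⟩ := h1
      rw [← ha.1 g K, haH]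
      ring
    · obtain ⟨g, rfl⟩ := h1
      rw [← ha.1 g K, haH]
      ring
    · rw [hβ K h2 h1]
      ring
    · ring

lemma blockVector_pos (hp : p.Prime) {K : Subgroup G} (hK : ¬ IsConjTo H K) :
    0 < blockVector p H K := by
  rw [blockVector, if_neg hK]
  split_ifs
  · exact_mod_cast hp.pos
  · exact one_pos

lemma blockVector_eq_zero {K : Subgroup G} (hK : IsConjTo H K) : blockVector p H K = 0 :=
  if_pos hK

open Classical in
/-- The idempotent of the ghost ring attached to the conjugacy class of `H`, times `|G|`. -/
def classVector (H K : Subgroup G) : ℤ := if IsConjTo H K then Nat.card G else 0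

lemma classVector_mem (H : Subgroup G) : classVector H ∈ congruenceSubring G := by
  refine ⟨fun g K => by classical simp only [classVector, isConjTo_conj_smul], fun p hp K L h => ?_⟩
  have key (K : Subgroup G) : (p : ℤ) ∣ classVector H K := by
    rw [classVector]
    split_ifs
    exacts [Int.natCast_dvd_natCast.2 h.dvd_card_group, dvd_zero _]
  exact dvd_sub (key K) (key L)

end BlockVector

/-- Let `G` be a finite group whose order is square-free.  Then for all subgroups `H, J ≤ G`
and all `l ≥ 1` there is an isomorphism of `A(G)`-modules
`Ext^l_{A(G)}(ℤ_H, ℤ_J) ≅ Ext^{l+2}_{A(G)}(ℤ_H, ℤ_J)`. -/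
theorem stmt_17 (G : Type) [Group G] [Finite G] (hG : Squarefree (Nat.card G))
    (H J : Subgroup G) (l : ℕ) (hl : 1 ≤ l) :
    Nonempty
      ((((Ext (burnsideRing G) (ModuleCat (burnsideRing G)) l).obj
          (Opposite.op (ZB G H))).obj (ZB G J)) ≅
       (((Ext (burnsideRing G) (ModuleCat (burnsideRing G)) (l + 2)).obj
          (Opposite.op (ZB G H))).obj (ZB G J))) := by
  obtain ⟨n, rfl⟩ : ∃ n, l = n + 1 := ⟨l - 1, by omega⟩
  have hle := congruenceSubring_le_burnsideRing hG
  let π : burnsideRing G →+* ℤ :=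
    (Pi.evalRingHom (fun _ => ℤ) H).comp (burnsideRing G).subtype
  have : IsNoetherian ℤ (burnsideRing G) :=
    isNoetherian_of_injective (burnsideRing G).subtype.toAddMonoidHom.toIntLinearMap
      Subtype.val_injective
  have hmem {p : ℕ} (hp : p ∈ (Nat.card G).primeFactors) :
      (fun K => ((Nat.card G / p : ℕ) : ℤ) * blockVector p H K) ∈ burnsideRing G :=
    hle (blockVector_mem hG (Nat.prime_of_mem_primeFactors hp) (Nat.dvd_of_mem_primeFactors hp) H)
  let z (p : ℕ) : burnsideRing G := if hp : p ∈ (Nat.card G).primeFactors then ⟨_, hmem hp⟩ else 0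
  have hz {p : ℕ} (hp : p ∈ (Nat.card G).primeFactors) (K : Subgroup G) :
      (z p : Subgroup G → ℤ) K = ((Nat.card G / p : ℕ) : ℤ) * blockVector p H K := by
    simp only [z, dif_pos hp]
  obtain ⟨m, hm, hdvd⟩ := exists_isCoprime_forall_sum_dvd (RingHom.ker π) hG z
    (fun p hp => by
      change (z p : Subgroup G → ℤ) H = 0
      rw [hz hp, blockVector_eq_zero (IsConjTo.refl H), mul_zero])
    (fun p hp => by
      have hpp := Nat.prime_of_mem_primeFactors hp
      have hpN := Nat.dvd_of_mem_primeFactors hp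
      refine ⟨((Nat.card G / p : ℕ) : ℤ) ^ 2,
        (Nat.isCoprime_iff_coprime.2 (Nat.coprime_of_squarefree_mul ?_)).pow_left, ?_⟩
      · rwa [Nat.div_mul_cancel hpN]
      · intro a ha
        obtain ⟨b, hb, hab⟩ := exists_mul_blockVector_eq hG hpp hpN
          (burnsideRing_le_congruenceSubring a.2) (H := H) ha
        refine ⟨⟨b, hle hb⟩, Subtype.ext (funext fun K => ?_)⟩
        simpa [hz hp] using hab K)
  set x : burnsideRing G :=
    ∑ p ∈ (Nat.card G).primeFactors, ((Nat.card G / p : ℕ) : burnsideRing G) * z p with hx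
  have hxK (K : Subgroup G) : (x : Subgroup G → ℤ) K =
      ∑ p ∈ (Nat.card G).primeFactors,
        ((Nat.card G / p : ℕ) : ℤ) * (((Nat.card G / p : ℕ) : ℤ) * blockVector p H K) := by
    rw [hx]
    simp only [AddSubmonoidClass.coe_finsetSum, Finset.sum_apply]
    exact Finset.sum_congr rfl fun p hp => by simp [hz hp]
  have hx0 {K : Subgroup G} (hK : IsConjTo H K) : (x : Subgroup G → ℤ) K = 0 := by
    rw [hxK]
    exact Finset.sum_eq_zero fun p _ => by rw [blockVector_eq_zero hK, mul_zero, mul_zero]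
  have hx1 {K : Subgroup G} (hK : ¬ IsConjTo H K) : (x : Subgroup G → ℤ) K ≠ 0 := by
    rw [hxK]
    refine (Finset.sum_pos (fun p hp => ?_) (Nat.nonempty_primeFactors.2 ?_)).ne'
    · have h1 : (0 : ℤ) < ((Nat.card G / p : ℕ) : ℤ) := by
        exact_mod_cast Nat.div_pos (Nat.le_of_dvd Nat.card_pos (Nat.dvd_of_mem_primeFactors hp))
          (Nat.pos_of_mem_primeFactors hp)
      exact mul_pos h1 (mul_pos h1 (blockVector_pos (Nat.prime_of_mem_primeFactors hp) hK))
    · by_contra h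
      have : Subsingleton G := Finite.card_le_one_iff_subsingleton.1 (not_lt.1 h)
      exact hK (Subsingleton.elim H K ▸ IsConjTo.refl H)
  refine nonempty_ext_iso_ext_add_two_of_ringHom π (ZB G H) (AddEquiv.refl ℤ) (fun _ _ => rfl) x
    ⟨classVector H, hle (classVector_mem H)⟩ hm (by exact_mod_cast Nat.card_pos.ne')
    (hx0 (IsConjTo.refl H)) hdvd ?_ ?_ (if_pos (IsConjTo.refl H)) (ZB G J) n
  · intro a hax ha
    refine Subtype.ext (funext fun K => ?_)
    by_cases hK : IsConjTo H K
    · obtain ⟨g, rfl⟩ := hK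
      exact ((burnsideRing_le_congruenceSubring a.2).1 g K).symm.trans ha
    · have h1 : (a : Subgroup G → ℤ) K * (x : Subgroup G → ℤ) K = 0 :=
        congrFun (congrArg Subtype.val hax) K
      exact (mul_eq_zero.1 h1).resolve_right (hx1 hK)
  · refine Subtype.ext (funext fun K => ?_)
    change classVector H K * (x : Subgroup G → ℤ) K = 0
    by_cases hK : IsConjTo H K
    · rw [hx0 hK, mul_zero]
    · rw [classVector, if_neg hK, zero_mul]
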